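/- Let N ≥ 3 be an integer, m(z) := ⌈-N·arg(z)/(2π)⌉ with arg(z) ∈ [-π, π), and for t ∈ ℤ let A_t := exp(2πit/N)·A_0 with A_0 := {z ∈ ℂ, z ≠ 0 : arg(z) ∈ [-π/(2N), π/(2N)]}. Then for every nonzero complex number z and all integers t, k: z·A_t = A_k if and only if both m(z) + m(z⁻¹) ≡ 0 (mod N) and m(z) ≡ t - k (mod N). -/

import Mathlib

/-- The principal argument of a nonzero complex number, normalized to lie in `[-π, π)`. -/
noncomputable def parg (z : ℂ) : ℝ :=
  if Complex.arg z = Real.pi then -Real.pi else Complex.arg z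

/-- `m(z) := ⌈-N·arg(z)/(2π)⌉` where `arg(z) ∈ [-π, π)`. -/
noncomputable def mfun (N : ℤ) (z : ℂ) : ℤ :=
  ⌈(-(N : ℝ) * parg z) / (2 * Real.pi)⌉

/-- The rotation `exp(2πit/N)`. -/
noncomputable def rot (N t : ℤ) : ℂ :=
  Complex.exp (2 * Real.pi * Complex.I * (t : ℂ) / (N : ℂ))

/-- The sector `S₀ = {z ≠ 0 : arg z ∈ [-π/(2N), 5π/(2N))}`. -/
noncomputable def S0 (N : ℤ) : Set ℂ :=
  {z | z ≠ 0 ∧ parg z ∈ Set.Ico (-(Real.pi / (2 * (N : ℝ)))) (5 * Real.pi / (2 * (N : ℝ)))}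

/-- The sector `S_t := exp(2πit/N)·S₀`. -/
noncomputable def Ssec (N t : ℤ) : Set ℂ := (fun w => rot N t * w) '' S0 N

/-- The arm `A₀ = {z ≠ 0 : arg z ∈ [-π/(2N), π/(2N)]}`. -/
noncomputable def A0 (N : ℤ) : Set ℂ :=
  {z | z ≠ 0 ∧ parg z ∈ Set.Icc (-(Real.pi / (2 * (N : ℝ)))) (Real.pi / (2 * (N : ℝ)))}

/-- The arm `A_t := exp(2πit/N)·A₀`. -/
noncomputable def Aarm (N t : ℤ) : Set ℂ := (fun w => rot N t * w) '' A0 N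

lemma aux_parg_angle (z : ℂ) : ((parg z : ℝ) : Real.Angle) = (Complex.arg z : Real.Angle) := by
  unfold parg
  split_ifs with h
  · rw [h]; simp
  · rfl

lemma aux_small {N : ℤ} (hN : 3 ≤ N) {z : ℂ} :
    z ∈ A0 N ↔ z ≠ 0 ∧ |Complex.arg z| ≤ Real.pi / (2 * (N : ℝ)) := by
  have hN' : (3 : ℝ) ≤ N := by exact_mod_cast hN
  have hpi := Real.pi_pos
  have h1 : Real.pi / (2 * (N : ℝ)) < Real.pi := by
    rw [div_lt_iff₀ (by linarith)]; nlinarith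
  unfold A0 parg
  simp only [Set.mem_setOf_eq, Set.mem_Icc, abs_le]
  split_ifs with h
  · rw [h]
    constructor
    · rintro ⟨_, h2, _⟩; linarith
    · rintro ⟨_, _, h2⟩; linarith
  · rfl

lemma aux_alpha {N : ℤ} (hN : 3 ≤ N) : 0 < Real.pi / (2 * (N : ℝ)) ∧
    Real.pi / (2 * (N : ℝ)) ≤ Real.pi / 6 := by
  have hN' : (3 : ℝ) ≤ N := by exact_mod_cast hN
  have hpi := Real.pi_pos
  constructor
  · positivity
  · apply div_le_div_of_nonneg_left <;> linarith

lemma aux_arm {N : ℤ} (hN : 3 ≤ N) {u : ℂ} (hu : u ≠ 0) :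
    (fun w => u * w) '' A0 N = A0 N ↔ Complex.arg u = 0 := by
  obtain ⟨ha0, ha1⟩ := aux_alpha hN
  have hpi := Real.pi_pos
  set α := Real.pi / (2 * (N : ℝ)) with hα
  constructor
  · intro h
    have key : ∀ w ∈ A0 N, u * w ∈ A0 N := fun w hw => h ▸ Set.mem_image_of_mem _ hw
    have h1 : |Complex.arg u| ≤ α := by
      have := key 1 (by rw [aux_small hN]; simp [← hα, ha0.le])
      rw [mul_one, aux_small hN] at this
      exact this.2
    rw [abs_le] at h1
    have h2 : ∀ β : ℝ, |β| ≤ α → |Complex.arg u + β| ≤ α := by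
      intro β hβ
      have hb := abs_le.1 hβ
      have hne : Complex.exp (β * Complex.I) ≠ 0 := Complex.exp_ne_zero _
      have hab : Complex.arg (Complex.exp (β * Complex.I)) = β := by
        rw [Complex.arg_exp_mul_I, toIocMod_eq_self]
        constructor <;> linarith
      have := key (Complex.exp (β * Complex.I)) (by
        rw [aux_small hN]; exact ⟨hne, by rw [hab]; exact hβ⟩)
      rw [aux_small hN, Complex.arg_mul hu hne (by rw [hab]; constructor <;> linarith), hab] at this
      exact this.2
    have h3 := abs_le.1 (h2 α (by rw [abs_of_pos ha0]))
    have h4 := abs_le.1 (h2 (-α) (by rw [abs_neg, abs_of_pos ha0]))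
    linarith
  · intro h
    have hmul : ∀ v : ℂ, v ≠ 0 → Complex.arg v = 0 → ∀ w ∈ A0 N, v * w ∈ A0 N := by
      intro v hv hv0 w hw
      rw [aux_small hN] at hw ⊢
      refine ⟨mul_ne_zero hv hw.1, ?_⟩
      rw [Complex.arg_mul hv hw.1, hv0, zero_add]
      · exact hw.2
      · rw [hv0, zero_add]; exact Complex.arg_mem_Ioc w
    apply Set.Subset.antisymm
    · rintro _ ⟨w, hw, rfl⟩
      exact hmul u hu h w hw
    · intro w hw
      refine ⟨u⁻¹ * w, hmul _ (inv_ne_zero hu) ?_ w hw, by simp [hu]⟩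
      rw [Complex.arg_inv, h]; simp [hpi.ne]

lemma aux_rot_ne (N t : ℤ) : rot N t ≠ 0 := Complex.exp_ne_zero _

lemma aux_rot_mul (N a b : ℤ) : rot N (a + b) = rot N a * rot N b := by
  unfold rot
  rw [← Complex.exp_add]
  congr 1
  push_cast
  ring

lemma aux_rot_zero (N : ℤ) : rot N 0 = 1 := by simp [rot]

lemma aux_rot_angle (N t : ℤ) :
    ((Complex.arg (rot N t) : ℝ) : Real.Angle) = ((2 * Real.pi * t / N : ℝ) : Real.Angle) := by
  have : rot N t = Complex.exp ((2 * Real.pi * t / N : ℝ) * Complex.I) := by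
    unfold rot; congr 1; push_cast; ring
  rw [this, Complex.arg_exp_mul_I, Real.Angle.coe_toIocMod]

lemma aux_left {N : ℤ} (hN : 3 ≤ N) {z : ℂ} (hz : z ≠ 0) (t k : ℤ) :
    ((fun w => z * w) '' Aarm N t = Aarm N k) ↔ Complex.arg (z * rot N (t - k)) = 0 := by
  rw [← aux_arm hN (mul_ne_zero hz (aux_rot_ne _ _))]
  have hinj : Function.Injective (fun w : ℂ => rot N k * w) :=
    mul_right_injective₀ (aux_rot_ne N k)
  have e : (fun w => z * w) '' Aarm N t =
      (fun w : ℂ => rot N k * w) '' ((fun w => z * rot N (t - k) * w) '' A0 N) := by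
    unfold Aarm
    rw [Set.image_image, Set.image_image]
    have : rot N t = rot N k * rot N (t - k) := by rw [← aux_rot_mul]; congr 1; ring
    rw [this]
    congr 1
    funext w
    ring
  rw [e]
  exact (Set.image_injective.2 hinj).eq_iff

lemma aux_mid {N : ℤ} (hN : 3 ≤ N) {z : ℂ} (hz : z ≠ 0) (d : ℤ) :
    Complex.arg (z * rot N d) = 0 ↔
      ∃ n : ℤ, (-(N : ℝ) * parg z) / (2 * Real.pi) = ((d - n * N : ℤ) : ℝ) := by
  have hpi := Real.pi_pos
  have hN' : (3 : ℝ) ≤ N := by exact_mod_cast hN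
  have hN0 : (N : ℝ) ≠ 0 := by linarith
  have h0 : Complex.arg (z * rot N d) = 0 ↔
      ((Complex.arg (z * rot N d) : ℝ) : Real.Angle) = ((0 : ℝ) : Real.Angle) := by
    rw [← Complex.arg_one, Complex.arg_coe_angle_eq_iff]
  rw [h0, Complex.arg_mul_coe_angle hz (aux_rot_ne _ _), aux_rot_angle, ← aux_parg_angle,
    ← Real.Angle.coe_add, Real.Angle.angle_eq_iff_two_pi_dvd_sub]
  refine exists_congr fun n => ?_
  push_cast
  rw [div_eq_iff (by positivity), sub_zero]
  constructor
  · intro h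
    field_simp at h
    linarith
  · intro h
    field_simp
    linarith

lemma aux_cond {N : ℤ} (hN : 3 ≤ N) (z : ℂ) :
    mfun N z + mfun N z⁻¹ ≡ 0 [ZMOD N] ↔
      ((mfun N z : ℤ) : ℝ) = (-(N : ℝ) * parg z) / (2 * Real.pi) := by
  have hpi := Real.pi_pos
  rw [Int.modEq_zero_iff_dvd]
  by_cases h : Complex.arg z = Real.pi
  · have hx : (-(N : ℝ) * parg z) / (2 * Real.pi) = (N : ℝ) / 2 := by
      rw [parg, if_pos h]; field_simp
    have hx' : (-(N : ℝ) * parg z⁻¹) / (2 * Real.pi) = (N : ℝ) / 2 := by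
      rw [parg, if_pos (by rw [Complex.arg_inv, if_pos h])]; field_simp
    have hm : mfun N z = ⌈(N : ℝ) / 2⌉ := by rw [mfun, hx]
    have hm' : mfun N z⁻¹ = ⌈(N : ℝ) / 2⌉ := by rw [mfun, hx']
    rw [hx, hm', hm]
    have h1 := Int.le_ceil ((N : ℝ) / 2)
    have h2 := Int.ceil_lt_add_one ((N : ℝ) / 2)
    generalize ⌈(N : ℝ) / 2⌉ = c at *
    have h1' : N ≤ 2 * c := by
      have : (N : ℝ) ≤ 2 * c := by linarith
      exact_mod_cast this
    have h2' : 2 * c < N + 2 := by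
      have : 2 * (c : ℝ) < N + 2 := by linarith
      exact_mod_cast this
    constructor
    · intro hd
      have : N ∣ 2 * c - N := by
        rw [two_mul]; exact dvd_sub_self_right.2 hd
      have := Int.eq_zero_of_dvd_of_nonneg_of_lt (by omega) (by omega) this
      have h3 : 2 * c = N := by omega
      have h4 : 2 * (c : ℝ) = N := by exact_mod_cast h3
      linarith
    · intro h3
      have h4 : 2 * (c : ℝ) = N := by linarith
      have h5 : 2 * c = N := by exact_mod_cast h4
      exact ⟨1, by omega⟩
  · have hp : parg z = Complex.arg z := by rw [parg, if_neg h]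
    have hp' : parg z⁻¹ = - parg z := by
      rw [hp, parg, Complex.arg_inv, if_neg h, if_neg]
      have := Complex.neg_pi_lt_arg z
      intro h'
      linarith
    have hm' : mfun N z⁻¹ = ⌈-((-(N : ℝ) * parg z) / (2 * Real.pi))⌉ := by
      rw [mfun, hp']; congr 1; ring
    rw [hm', mfun]
    generalize (-(N : ℝ) * parg z) / (2 * Real.pi) = x
    rw [Int.ceil_neg]
    have a1 := Int.le_ceil x
    have a2 := Int.ceil_lt_add_one x
    have a3 := Int.floor_le x
    have a4 := Int.lt_floor_add_one x
    generalize ⌈x⌉ = c at *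
    generalize ⌊x⌋ = f at *
    have b1 : f ≤ c := by
      have : (f : ℝ) ≤ c := by linarith
      exact_mod_cast this
    have b2 : c < f + 2 := by
      have : (c : ℝ) < f + 2 := by linarith
      exact_mod_cast this
    constructor
    · intro hd
      have := Int.eq_zero_of_dvd_of_nonneg_of_lt (by omega) (by omega) hd
      have h3 : c = f := by omega
      subst h3
      linarith
    · intro h3
      have : (c : ℝ) < f + 1 := by linarith
      have : c < f + 1 := by exact_mod_cast this
      exact ⟨0, by omega⟩

theorem stmt6 (N : ℤ) (hN : 3 ≤ N) (z : ℂ) (hz : z ≠ 0) (t k : ℤ) :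
    ((fun w => z * w) '' Aarm N t = Aarm N k) ↔
      (mfun N z + mfun N z⁻¹ ≡ 0 [ZMOD N] ∧ mfun N z ≡ t - k [ZMOD N]) := by
  rw [aux_left hN hz, aux_mid hN hz, aux_cond hN]
  constructor
  · rintro ⟨n, hn⟩
    have hm : mfun N z = t - k - n * N := by rw [mfun, hn, Int.ceil_intCast]
    refine ⟨by rw [hm, hn], ?_⟩
    rw [hm, Int.modEq_iff_dvd]
    exact ⟨n, by ring⟩
  · rintro ⟨h1, h2⟩
    obtain ⟨n, hn⟩ := Int.modEq_iff_dvd.1 h2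
    refine ⟨n, ?_⟩
    rw [← h1]
    congr 1
    linarith
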